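/- S_{χ₁,χ₂}(γ) is a rational number for every γ ∈ Γ₀(q₁q₂) if, and only if, χ₁ and χ₂ are quadratic characters (i.e., both χ₁ and χ₂ take only real values, equivalently χ₁² and χ₂² are trivial). -/

import Mathlib

open scoped BigOperators

/-- The sawtooth (first Bernoulli) function `B₁`. -/
noncomputable def sawtooth (x : ℝ) : ℝ :=
  open scoped Classical in
  if ∃ n : ℤ, x = (n : ℝ) then 0 else x - ⌊x⌋ - 1 / 2

/-- The newform Dedekind sum `S_{χ₁,χ₂}(h,k)`. -/
noncomputable def newformDedekindSum {q₁ q₂ : ℕ} (χ₁ : DirichletCharacter ℂ q₁)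
    (χ₂ : DirichletCharacter ℂ q₂) (h k : ℤ) : ℂ :=
  ∑ j ∈ Finset.range k.toNat, ∑ n ∈ Finset.range q₁,
    (starRingEnd ℂ) (χ₂ (j : ZMod q₂)) * (starRingEnd ℂ) (χ₁ (n : ZMod q₁)) *
      (sawtooth ((j : ℝ) / (k : ℝ)) : ℝ) *
      (sawtooth ((n : ℝ) / (q₁ : ℝ) + (h : ℝ) * (j : ℝ) / (k : ℝ)) : ℝ)

/-- The newform Dedekind sum of a matrix `γ`, via its left column. -/
noncomputable def SGamma {q₁ q₂ : ℕ} (χ₁ : DirichletCharacter ℂ q₁)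
    (χ₂ : DirichletCharacter ℂ q₂) (γ : Matrix.SpecialLinearGroup (Fin 2) ℤ) : ℂ :=
  if 0 < (γ : Matrix (Fin 2) (Fin 2) ℤ) 1 0 then
    newformDedekindSum χ₁ χ₂ ((γ : Matrix (Fin 2) (Fin 2) ℤ) 0 0)
      ((γ : Matrix (Fin 2) (Fin 2) ℤ) 1 0)
  else if (γ : Matrix (Fin 2) (Fin 2) ℤ) 1 0 < 0 then
    newformDedekindSum χ₁ χ₂ (-(γ : Matrix (Fin 2) (Fin 2) ℤ) 0 0)
      (-(γ : Matrix (Fin 2) (Fin 2) ℤ) 1 0)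
  else 0

open scoped ComplexConjugate

section Sawtooth

theorem sawtooth_eq_fract (x : ℝ) :
    sawtooth x = if Int.fract x = 0 then 0 else Int.fract x - 1 / 2 := by
  have h : (∃ n : ℤ, x = (n : ℝ)) ↔ Int.fract x = 0 := by
    rw [Int.fract_eq_zero_iff]
    constructor
    · rintro ⟨n, rfl⟩
      exact ⟨n, rfl⟩
    · rintro ⟨n, rfl⟩
      exact ⟨n, rfl⟩
  unfold sawtooth
  simp only [h]
  rfl

theorem sawtooth_add_intCast (x : ℝ) (m : ℤ) : sawtooth (x + m) = sawtooth x := by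
  simp [sawtooth_eq_fract]

theorem sawtooth_neg (x : ℝ) : sawtooth (-x) = -sawtooth x := by
  by_cases h : Int.fract x = 0
  · simp [sawtooth_eq_fract, h, Int.fract_neg_eq_zero.2 h]
  · have h' : Int.fract (-x) ≠ 0 := fun h0 => h (Int.fract_neg_eq_zero.1 h0)
    rw [sawtooth_eq_fract, sawtooth_eq_fract, if_neg h, if_neg h', Int.fract_neg h]
    ring

theorem sawtooth_of_mem_Ioo {x : ℝ} (h0 : 0 < x) (h1 : x < 1) : sawtooth x = x - 1 / 2 := by
  rw [sawtooth_eq_fract, Int.fract_eq_self.2 ⟨h0.le, h1⟩, if_neg h0.ne']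

/-- Shifting an average over the `M`-torsion points by such a point does not change it. -/
theorem sum_range_shift {g : ℝ → ℝ} (hg : Function.Periodic g 1) {M : ℕ} (hM : 0 < M) :
    Function.Periodic (fun s : ℝ => ∑ t ∈ Finset.range M, g (s + t / M)) (1 / M) := by
  intro s
  have hM' : (M : ℝ) ≠ 0 := by positivity
  have h1 := Finset.sum_range_succ (fun t : ℕ => g (s + (t : ℝ) / M)) M
  have h2 := Finset.sum_range_succ' (fun t : ℕ => g (s + (t : ℝ) / M)) M
  rw [h1] at h2
  have h3 : g (s + (M : ℝ) / M) = g s := by rw [div_self hM']; exact hg s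
  simp only [h3, Nat.cast_zero, zero_div, add_zero] at h2
  have h4 := add_right_cancel h2
  simp only
  rw [h4]
  refine Finset.sum_congr rfl fun t _ => ?_
  congr 1
  push_cast
  ring

theorem sum_sawtooth_distribution {p : ℕ} (hp : 0 < p) (y : ℝ) :
    ∑ b ∈ Finset.range p, sawtooth (y + b / p) = sawtooth (p * y) := by
  have hp' : (0 : ℝ) < p := by positivity
  have hper := sum_range_shift (g := sawtooth) (fun x => by simpa using sawtooth_add_intCast x 1) hp
  have hrep : y = Int.fract (p * y) / p + ⌊p * y⌋ • (1 / (p : ℝ)) := by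
    rw [zsmul_eq_mul, Int.fract]
    field_simp
    ring
  set z := Int.fract (p * y) with hz
  have hz0 : 0 ≤ z := Int.fract_nonneg _
  have hz1 : z < 1 := Int.fract_lt_one _
  have key : ∑ b ∈ Finset.range p, sawtooth (z / p + b / p) = sawtooth z := by
    have hsum : ∑ b ∈ Finset.range p, (b : ℝ) = p * (p - 1) / 2 := by
      clear * -
      induction p with
      | zero => simp
      | succ n ih => rw [Finset.sum_range_succ, ih]; push_cast; ring
    have hlt : ∀ b ∈ Finset.range p, z / p + b / p < 1 := by
      intro b hb
      rw [← add_div, div_lt_one hp']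
      have : (b : ℝ) + 1 ≤ p := by exact_mod_cast Finset.mem_range.1 hb
      linarith
    rcases hz0.eq_or_lt with h0 | h0
    · rw [← h0]
      have e1 : ∀ b ∈ Finset.range p, sawtooth (0 / (p : ℝ) + b / p) =
          ((b : ℝ) / p - 1 / 2) + if b = 0 then 1 / 2 else 0 := by
        intro b hb
        rcases Nat.eq_zero_or_pos b with rfl | hb0
        · simp [sawtooth_eq_fract]
        · have h := hlt b hb
          rw [← h0] at h
          have hb' : (0 : ℝ) < b := by exact_mod_cast hb0
          rw [sawtooth_of_mem_Ioo (by positivity) h, if_neg hb0.ne']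
          ring
      rw [Finset.sum_congr rfl e1, Finset.sum_add_distrib, Finset.sum_sub_distrib,
        ← Finset.sum_div, hsum, Finset.sum_ite_eq' (Finset.range p) 0,
        if_pos (Finset.mem_range.2 hp)]
      simp only [Finset.sum_const, Finset.card_range, nsmul_eq_mul]
      rw [sawtooth_eq_fract, if_pos Int.fract_zero]
      field_simp
      ring
    · rw [sawtooth_of_mem_Ioo h0 hz1]
      have e1 : ∀ b ∈ Finset.range p, sawtooth (z / (p : ℝ) + b / p) =
          (z / p - 1 / 2) + (b : ℝ) / p := by
        intro b hb
        rw [sawtooth_of_mem_Ioo (by positivity) (hlt b hb)]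
        ring
      rw [Finset.sum_congr rfl e1, Finset.sum_add_distrib, ← Finset.sum_div, hsum]
      simp only [Finset.sum_const, Finset.card_range, nsmul_eq_mul]
      field_simp
      ring
  calc ∑ b ∈ Finset.range p, sawtooth (y + b / p)
      = ∑ b ∈ Finset.range p, sawtooth (z / p + b / p) := by
        have h := (hper.zsmul ⌊p * y⌋) (z / p)
        rw [← hrep] at h
        exact h
    _ = sawtooth z := key
    _ = sawtooth (p * y) := by
        have h := sawtooth_add_intCast z ⌊p * y⌋
        rw [hz, Int.fract_add_floor] at h
        exact h.symm

/-- The product formula for two values of the sawtooth function at non-integral points. -/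
theorem sawtooth_mul_sawtooth {u y : ℝ} (hu : Int.fract u ≠ 0) (hv : Int.fract (u + y) ≠ 0) :
    sawtooth u * sawtooth (u + y) =
      (sawtooth u ^ 2 + sawtooth (u + y) ^ 2 + (Int.fract y ^ 2 - Int.fract y)) / 2 -
        sawtooth y * (sawtooth (u + y) - sawtooth u) := by
  have hv' : u + y = Int.fract (u + y) + ⌊u + y⌋ := (Int.fract_add_floor _).symm
  have hu' : u = Int.fract u + ⌊u⌋ := (Int.fract_add_floor _).symm
  have a0 := Int.fract_nonneg u
  have a1 := Int.fract_lt_one u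
  have b0 := Int.fract_nonneg (u + y)
  have b1 := Int.fract_lt_one (u + y)
  rw [sawtooth_eq_fract u, sawtooth_eq_fract (u + y), if_neg hu, if_neg hv]
  set a := Int.fract u
  set b := Int.fract (u + y)
  have hy : y = (b - a) + ((⌊u + y⌋ - ⌊u⌋ : ℤ) : ℝ) := by push_cast; linarith
  rcases lt_or_ge b a with h | h
  · have hf : Int.fract y = b - a + 1 := by
      rw [Int.fract_eq_iff]
      refine ⟨by linarith, by linarith, ⌊u + y⌋ - ⌊u⌋ - 1, ?_⟩
      push_cast at hy ⊢
      linarith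
    rw [sawtooth_eq_fract y, hf, if_neg (by linarith)]
    ring
  · have hf : Int.fract y = b - a := by
      rw [Int.fract_eq_iff]
      refine ⟨by linarith, by linarith, ⌊u + y⌋ - ⌊u⌋, ?_⟩
      linarith
    rw [sawtooth_eq_fract y, hf]
    split_ifs with h0
    · rw [show b = a by linarith]
      ring
    · ring

end Sawtooth

section Sums

theorem sum_range_mul_eq {M : Type*} [AddCommMonoid M] (f : ℕ → M) (k p : ℕ) :
    ∑ j ∈ Finset.range (k * p), f j =
      ∑ i ∈ Finset.range p, ∑ j ∈ Finset.range k, f (k * i + j) := by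
  induction p with
  | zero => simp
  | succ p ih => rw [mul_add, mul_one, Finset.sum_range_add, ih, Finset.sum_range_succ]

theorem sum_range_ite_dvd {M : Type*} [AddCommMonoid M] (f : ℕ → M) (k : ℕ) {p : ℕ} (hp : 0 < p) :
    ∑ j ∈ Finset.range (p * k), (if p ∣ j then f j else 0) =
      ∑ j ∈ Finset.range k, f (p * j) := by
  rw [sum_range_mul_eq]
  refine Finset.sum_congr rfl fun i _ => ?_
  rw [Finset.sum_eq_single_of_mem 0 (Finset.mem_range.2 hp)]
  · simp
  · intro b hb hb0
    rw [if_neg]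
    intro h
    exact hb0 (Nat.eq_zero_of_dvd_of_lt ((Nat.dvd_add_right (dvd_mul_right p i)).1 h)
      (Finset.mem_range.1 hb))

theorem periodic_eq_val {M : Type*} {q : ℕ} [NeZero q] {g : ℤ → M}
    (hg : Function.Periodic g (q : ℤ)) (x : ℤ) : g x = g ((x : ZMod q).val) := by
  rw [ZMod.val_intCast]
  conv_lhs => rw [← Int.emod_add_mul_ediv x q, mul_comm]
  have h := hg.zsmul (x / q) (x % q)
  rwa [smul_eq_mul] at h

theorem sum_range_eq_sum_zmod {M : Type*} [AddCommMonoid M] {q : ℕ} [NeZero q] (g : ℕ → M) :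
    ∑ n ∈ Finset.range q, g n = ∑ a : ZMod q, g a.val := by
  refine Finset.sum_bij' (fun n _ => (n : ZMod q)) (fun a _ => a.val) ?_ ?_ ?_ ?_ ?_
  · simp
  · intro a _
    exact Finset.mem_range.2 (ZMod.val_lt a)
  · intro n hn
    exact ZMod.val_cast_of_lt (Finset.mem_range.1 hn)
  · intro a _
    exact ZMod.natCast_zmod_val a
  · intro n hn
    rw [ZMod.val_cast_of_lt (Finset.mem_range.1 hn)]

theorem sum_range_periodic_mul {M : Type*} [AddCommMonoid M] {q : ℕ} [NeZero q] {g : ℤ → M}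
    (hg : Function.Periodic g (q : ℤ)) {p : ℤ} (hp : IsUnit (p : ZMod q)) :
    ∑ n ∈ Finset.range q, g (p * n) = ∑ n ∈ Finset.range q, g n := by
  rw [sum_range_eq_sum_zmod (fun n => g (p * n)), sum_range_eq_sum_zmod (fun n => g n)]
  refine Fintype.sum_equiv (Units.mulLeft hp.unit) _ _ fun a => ?_
  rw [periodic_eq_val hg]
  simp

end Sums

theorem conj_mul_self_of_isUnit {q : ℕ} (χ : DirichletCharacter ℂ q) {a : ZMod q} (ha : IsUnit a) :
    χ a * conj (χ a) = 1 := by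
  have h := MulChar.star_apply' χ a
  rw [starRingEnd_apply, h, ← MulChar.mul_apply, mul_inv_cancel, MulChar.one_apply ha]

/-- The sawtooth function twisted by the conjugate of a character. -/
noncomputable def charSawtooth {q : ℕ} (χ : DirichletCharacter ℂ q) (x : ℝ) : ℂ :=
  ∑ n ∈ Finset.range q, conj (χ (n : ZMod q)) * (sawtooth ((n : ℝ) / (q : ℝ) + x) : ℝ)

section CharSawtooth

variable {q : ℕ} (χ : DirichletCharacter ℂ q)

theorem charSawtooth_add_intCast (x : ℝ) (m : ℤ) : charSawtooth χ (x + m) = charSawtooth χ x := by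
  simp only [charSawtooth, ← add_assoc, sawtooth_add_intCast]

theorem sum_conj_mul_sawtooth_mul [NeZero q] {p : ℤ} (hp : IsUnit (p : ZMod q)) (z : ℝ) :
    ∑ n ∈ Finset.range q, conj (χ (n : ZMod q)) * (sawtooth (p * ((n : ℝ) / q) + z) : ℝ) =
      χ (p : ZMod q) * charSawtooth χ z := by
  have hq : (q : ℝ) ≠ 0 := NeZero.ne _
  have hper : Function.Periodic
      (fun n : ℤ => conj (χ (n : ZMod q)) * ((sawtooth ((n : ℝ) / q + z) : ℝ) : ℂ)) (q : ℤ) := by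
    intro n
    have e : ((n + (q : ℤ) : ℤ) : ℝ) / q + z = ((n : ℝ) / q + z) + ((1 : ℤ) : ℝ) := by
      push_cast
      field_simp
      ring
    simp only [e, sawtooth_add_intCast]
    simp
  have h := sum_range_periodic_mul hper hp
  simp only [Int.cast_mul, Int.cast_natCast, map_mul] at h
  rw [charSawtooth, ← h, Finset.mul_sum]
  refine Finset.sum_congr rfl fun n _ => ?_
  rw [← mul_assoc, ← mul_assoc, conj_mul_self_of_isUnit χ hp, one_mul, mul_div_assoc]

theorem charSawtooth_neg [NeZero q] (x : ℝ) :
    charSawtooth χ (-x) = -(χ (-1) * charSawtooth χ x) := by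
  have h := sum_conj_mul_sawtooth_mul χ (p := -1) (by simp) x
  rw [show (((-1 : ℤ) : ZMod q)) = -1 by simp] at h
  rw [← h, charSawtooth, ← Finset.sum_neg_distrib]
  refine Finset.sum_congr rfl fun n _ => ?_
  rw [show (n : ℝ) / q + -x = -((-1 : ℤ) * ((n : ℝ) / q) + x) by push_cast; ring, sawtooth_neg]
  push_cast
  ring

theorem sum_charSawtooth_distribution [NeZero q] {p : ℕ} (hp0 : 0 < p)
    (hp : IsUnit (p : ZMod q)) (x : ℝ) :
    ∑ b ∈ Finset.range p, charSawtooth χ (x + b / p) = χ p * charSawtooth χ (p * x) := by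
  have h := sum_conj_mul_sawtooth_mul χ (p := p) (by simpa using hp) (p * x)
  simp only [Int.cast_natCast] at h
  rw [← h]
  simp only [charSawtooth]
  rw [Finset.sum_comm]
  refine Finset.sum_congr rfl fun n _ => ?_
  rw [← Finset.mul_sum, ← mul_add, ← sum_sawtooth_distribution hp0, Complex.ofReal_sum]
  simp only [add_assoc]

/-- The sum of the twisted sawtooth function along a multiple of the `p`-torsion points. -/
theorem sum_charSawtooth_mul_div [NeZero q] {p : ℕ} (hp : p.Prime)
    (hpq : IsUnit (p : ZMod q)) (x : ℝ) (j : ℕ) :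
    ∑ b ∈ Finset.range p, charSawtooth χ (x + (b : ℝ) * j / p) =
      if p ∣ j then p * charSawtooth χ x else χ p * charSawtooth χ (p * x) := by
  have hp' : (p : ℝ) ≠ 0 := by exact_mod_cast hp.ne_zero
  have : NeZero p := ⟨hp.ne_zero⟩
  split_ifs with h
  · obtain ⟨m, rfl⟩ := h
    have e : ∀ b ∈ Finset.range p,
        charSawtooth χ (x + (b : ℝ) * ((p * m : ℕ) : ℝ) / p) = charSawtooth χ x := by
      intro b _
      rw [← charSawtooth_add_intCast χ x (b * m)]
      congr 2
      push_cast
      field_simp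
    rw [Finset.sum_congr rfl e]
    simp
  · rw [← sum_charSawtooth_distribution χ hp.pos hpq]
    have hper : Function.Periodic (fun b : ℤ => charSawtooth χ (x + (b : ℝ) / p)) (p : ℤ) := by
      intro b
      simp only
      rw [← charSawtooth_add_intCast χ (x + (b : ℝ) / p) 1]
      congr 1
      push_cast
      field_simp
      ring
    have hj : IsUnit (((j : ℕ) : ℤ) : ZMod p) := by
      rw [Int.cast_natCast, ZMod.isUnit_iff_coprime]
      exact ((Nat.Prime.coprime_iff_not_dvd hp).2 h).symm
    have h := sum_range_periodic_mul hper hj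
    simp only [Int.cast_mul, Int.cast_natCast] at h
    rw [← h]
    refine Finset.sum_congr rfl fun b _ => ?_
    rw [mul_comm (b : ℝ)]

end CharSawtooth

section Hecke

variable {q₁ q₂ : ℕ} (χ₁ : DirichletCharacter ℂ q₁) (χ₂ : DirichletCharacter ℂ q₂)

theorem newformDedekindSum_natCast (h : ℤ) (k : ℕ) :
    newformDedekindSum χ₁ χ₂ h k = ∑ j ∈ Finset.range k,
      conj (χ₂ (j : ZMod q₂)) * (sawtooth ((j : ℝ) / k) : ℝ) *
        charSawtooth χ₁ ((h : ℝ) * j / k) := by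
  simp only [newformDedekindSum, charSawtooth, Int.toNat_natCast, Int.cast_natCast, Finset.mul_sum]
  refine Finset.sum_congr rfl fun j _ => Finset.sum_congr rfl fun n _ => ?_
  ring

theorem newformDedekindSum_neg [NeZero q₁] (h : ℤ) (k : ℕ) :
    newformDedekindSum χ₁ χ₂ (-h) k = -(χ₁ (-1) * newformDedekindSum χ₁ χ₂ h k) := by
  simp only [newformDedekindSum_natCast]
  rw [Finset.mul_sum, ← Finset.sum_neg_distrib]
  refine Finset.sum_congr rfl fun j _ => ?_
  rw [show ((-h : ℤ) : ℝ) * j / k = -((h : ℝ) * j / k) by push_cast; ring, charSawtooth_neg]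
  ring

theorem newformDedekindSum_congr {h h' : ℤ} {k : ℕ} (hk : 0 < k) (hh : h ≡ h' [ZMOD k]) :
    newformDedekindSum χ₁ χ₂ h k = newformDedekindSum χ₁ χ₂ h' k := by
  have hk' : (k : ℝ) ≠ 0 := by positivity
  obtain ⟨m, hm⟩ := hh.dvd
  obtain rfl : h' = h + k * m := by linarith
  simp only [newformDedekindSum_natCast]
  refine Finset.sum_congr rfl fun j _ => ?_
  rw [← charSawtooth_add_intCast χ₁ _ (m * j)]
  congr 2
  push_cast
  field_simp

theorem sum_mul_sawtooth_mul_of_dvd {k p : ℕ} (hk : 0 < k) (hp : 0 < p) (hq : q₂ ∣ k) (h : ℤ) :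
    ∑ j ∈ Finset.range (p * k), conj (χ₂ (j : ZMod q₂)) * (sawtooth ((j : ℝ) / (p * k)) : ℝ) *
        charSawtooth χ₁ ((h : ℝ) * j / k) = newformDedekindSum χ₁ χ₂ h k := by
  have hk' : (k : ℝ) ≠ 0 := by positivity
  have hp' : (p : ℝ) ≠ 0 := by positivity
  have hkq : (k : ZMod q₂) = 0 := (ZMod.natCast_eq_zero_iff _ _).2 hq
  rw [mul_comm p k, sum_range_mul_eq, Finset.sum_comm, newformDedekindSum_natCast]
  refine Finset.sum_congr rfl fun j _ => ?_
  have e1 : ∀ i ∈ Finset.range p,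
      conj (χ₂ ((k * i + j : ℕ) : ZMod q₂)) *
        (sawtooth (((k * i + j : ℕ) : ℝ) / (p * k)) : ℝ) *
        charSawtooth χ₁ ((h : ℝ) * (k * i + j : ℕ) / k) =
      conj (χ₂ (j : ZMod q₂)) * charSawtooth χ₁ ((h : ℝ) * j / k) *
        (sawtooth ((j : ℝ) / (p * k) + i / p) : ℝ) := by
    intro i _
    rw [show (h : ℝ) * (k * i + j : ℕ) / k = (h : ℝ) * j / k + ((h * i : ℤ) : ℝ) by
        push_cast; field_simp; ring, charSawtooth_add_intCast,
      show (((k * i + j : ℕ) : ℝ) / (p * k)) = (j : ℝ) / (p * k) + i / p by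
        push_cast; field_simp; ring]
    push_cast
    rw [hkq]
    simp only [zero_mul, zero_add]
    ring
  rw [Finset.sum_congr rfl e1, ← Finset.mul_sum, ← Complex.ofReal_sum,
    sum_sawtooth_distribution hp, show (p : ℝ) * ((j : ℝ) / (p * k)) = j / k by field_simp]
  ring

theorem newformDedekindSum_mul_mul {k p : ℕ} (hk : 0 < k) (hp : 0 < p) (hq : q₂ ∣ k) (h : ℤ) :
    newformDedekindSum χ₁ χ₂ (p * h) (p * k : ℕ) = newformDedekindSum χ₁ χ₂ h k := by
  have hp' : (p : ℝ) ≠ 0 := by positivity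
  have hk' : (k : ℝ) ≠ 0 := by positivity
  rw [← sum_mul_sawtooth_mul_of_dvd χ₁ χ₂ hk hp hq, newformDedekindSum_natCast]
  refine Finset.sum_congr rfl fun j _ => ?_
  rw [show ((p * h : ℤ) : ℝ) * j / (p * k : ℕ) = (h : ℝ) * j / k by push_cast; field_simp]
  push_cast
  rfl

/-- The Hecke relation at a prime (an analogue of the Petersson-Knopp identity). -/
theorem sum_newformDedekindSum_add_mul [NeZero q₁] {k p : ℕ} (hk : 0 < k) (hp : p.Prime)
    (hpq : IsUnit (p : ZMod q₁)) (hq : q₂ ∣ k) (h : ℤ) :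
    ∑ b ∈ Finset.range p, newformDedekindSum χ₁ χ₂ (h + b * k) (p * k : ℕ) =
      (χ₁ p + p * conj (χ₂ p)) * newformDedekindSum χ₁ χ₂ h k -
        χ₁ p * conj (χ₂ p) * newformDedekindSum χ₁ χ₂ (p * h) k := by
  have hp' : (p : ℝ) ≠ 0 := by exact_mod_cast hp.ne_zero
  have hk' : (k : ℝ) ≠ 0 := by positivity
  simp only [newformDedekindSum_natCast χ₁ χ₂ _ (p * k)]
  rw [Finset.sum_comm]
  have e1 : ∀ j ∈ Finset.range (p * k),
      ∑ b ∈ Finset.range p, conj (χ₂ (j : ZMod q₂)) *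
        (sawtooth ((j : ℝ) / (p * k : ℕ)) : ℝ) *
          charSawtooth χ₁ (((h + b * k : ℤ) : ℝ) * j / (p * k : ℕ)) =
      χ₁ p * (conj (χ₂ (j : ZMod q₂)) * (sawtooth ((j : ℝ) / (p * k)) : ℝ) *
        charSawtooth χ₁ ((h : ℝ) * j / k)) +
      if p ∣ j then conj (χ₂ (j : ZMod q₂)) * (sawtooth ((j : ℝ) / (p * k)) : ℝ) *
        (p * charSawtooth χ₁ ((h : ℝ) * j / (p * k)) -
          χ₁ p * charSawtooth χ₁ ((h : ℝ) * j / k)) else 0 := by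
    intro j _
    rw [← Finset.mul_sum]
    have e2 : ∀ b ∈ Finset.range p,
        charSawtooth χ₁ (((h + b * k : ℤ) : ℝ) * j / (p * k : ℕ)) =
          charSawtooth χ₁ ((h : ℝ) * j / (p * k) + (b : ℝ) * j / p) := by
      intro b _
      congr 1
      push_cast
      field_simp
    rw [Finset.sum_congr rfl e2, sum_charSawtooth_mul_div χ₁ hp hpq,
      show (p : ℝ) * ((h : ℝ) * j / (p * k)) = (h : ℝ) * j / k by field_simp]
    push_cast
    split_ifs <;> ring
  rw [Finset.sum_congr rfl e1, Finset.sum_add_distrib, ← Finset.mul_sum,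
    sum_mul_sawtooth_mul_of_dvd χ₁ χ₂ hk hp.pos hq, sum_range_ite_dvd _ _ hp.pos]
  have e3 : ∀ j ∈ Finset.range k,
      conj (χ₂ ((p * j : ℕ) : ZMod q₂)) * (sawtooth (((p * j : ℕ) : ℝ) / (p * k)) : ℝ) *
        (p * charSawtooth χ₁ ((h : ℝ) * (p * j : ℕ) / (p * k)) -
          χ₁ p * charSawtooth χ₁ ((h : ℝ) * (p * j : ℕ) / k)) =
      p * conj (χ₂ p) * (conj (χ₂ (j : ZMod q₂)) * (sawtooth ((j : ℝ) / k) : ℝ) *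
        charSawtooth χ₁ ((h : ℝ) * j / k)) -
      χ₁ p * conj (χ₂ p) * (conj (χ₂ (j : ZMod q₂)) * (sawtooth ((j : ℝ) / k) : ℝ) *
        charSawtooth χ₁ (((p * h : ℤ) : ℝ) * j / k)) := by
    intro j _
    rw [show (((p * j : ℕ) : ℝ) / (p * k)) = j / k by push_cast; field_simp,
      show (h : ℝ) * (p * j : ℕ) / (p * k) = (h : ℝ) * j / k by push_cast; field_simp,
      show (h : ℝ) * (p * j : ℕ) / k = ((p * h : ℤ) : ℝ) * j / k by push_cast; ring]
    push_cast
    rw [map_mul, map_mul]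
    ring
  rw [Finset.sum_congr rfl e3, Finset.sum_sub_distrib, ← Finset.mul_sum, ← Finset.mul_sum,
    ← newformDedekindSum_natCast, ← newformDedekindSum_natCast]
  ring

end Hecke

section Nonvanishing

theorem sum_conj_eq_zero {q : ℕ} [NeZero q] {χ : DirichletCharacter ℂ q} (hχ : χ ≠ 1) :
    ∑ n ∈ Finset.range q, conj (χ (n : ZMod q)) = 0 := by
  rw [← map_sum, sum_range_eq_sum_zmod (fun n => χ (n : ZMod q))]
  simp [MulChar.sum_eq_zero_of_ne_one hχ]

theorem DirichletCharacter.IsPrimitive.ne_one {q : ℕ} (hq : 1 < q) {χ : DirichletCharacter ℂ q}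
    (hχ : χ.IsPrimitive) : χ ≠ 1 := by
  rintro rfl
  have : NeZero q := ⟨by lia⟩
  rw [DirichletCharacter.isPrimitive_def, DirichletCharacter.conductor_one] at hχ
  lia

theorem fract_ne_zero_of_not_dvd {q M : ℕ} (hq : 0 < q) (hM : 0 < M) {r : ℕ} (hr : ¬ q ∣ r)
    (c : ℤ) : Int.fract ((r : ℝ) / (q * M) + (c : ℝ) / M) ≠ 0 := by
  have hq' : (q : ℝ) ≠ 0 := by positivity
  have hM' : (M : ℝ) ≠ 0 := by positivity
  rw [Ne, Int.fract_eq_zero_iff]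
  rintro ⟨z, hz⟩
  field_simp at hz
  have h : z * q * M = r + c * q := by exact_mod_cast (by linarith : (z : ℝ) * q * M = r + c * q)
  refine hr (Int.natCast_dvd_natCast.1 ⟨z * M - c, ?_⟩)
  linarith

theorem sum_sawtooth_mul_sawtooth {q M : ℕ} (hq : 0 < q) (hM : 0 < M) {r : ℕ} (hr : ¬ q ∣ r)
    {y : ℝ} {c : ℤ} (hy : y = c / M) :
    ∑ t ∈ Finset.range M, sawtooth ((r : ℝ) / (q * M) + t / M) *
        sawtooth ((r : ℝ) / (q * M) + t / M + y) =
      ∑ t ∈ Finset.range M, sawtooth ((r : ℝ) / (q * M) + t / M) ^ 2 +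
        M / 2 * (Int.fract y ^ 2 - Int.fract y) := by
  have hM' : (M : ℝ) ≠ 0 := by positivity
  have shift : ∀ g : ℝ → ℝ, Function.Periodic g 1 →
      ∑ t ∈ Finset.range M, g ((r : ℝ) / (q * M) + t / M + y) =
        ∑ t ∈ Finset.range M, g ((r : ℝ) / (q * M) + t / M) := by
    intro g hg
    have h := ((sum_range_shift hg hM).zsmul c) ((r : ℝ) / (q * M))
    rw [← h]
    refine Finset.sum_congr rfl fun t _ => ?_
    congr 1
    rw [hy, zsmul_eq_mul]
    ring
  have hper : Function.Periodic sawtooth 1 := fun x => by simpa using sawtooth_add_intCast x 1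
  have h1 := shift sawtooth hper
  have h2 := shift (fun x => sawtooth x ^ 2) (fun x => by simp only [hper x])
  have e : ∀ t ∈ Finset.range M, sawtooth ((r : ℝ) / (q * M) + t / M) *
        sawtooth ((r : ℝ) / (q * M) + t / M + y) =
      (sawtooth ((r : ℝ) / (q * M) + t / M) ^ 2 +
        sawtooth ((r : ℝ) / (q * M) + t / M + y) ^ 2 + (Int.fract y ^ 2 - Int.fract y)) / 2 -
      sawtooth y * (sawtooth ((r : ℝ) / (q * M) + t / M + y) -
        sawtooth ((r : ℝ) / (q * M) + t / M)) := by
    intro t _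
    refine sawtooth_mul_sawtooth ?_ ?_
    · exact_mod_cast fract_ne_zero_of_not_dvd hq hM hr t
    · have h := fract_ne_zero_of_not_dvd hq hM hr (t + c)
      rwa [show (r : ℝ) / (q * M) + ((t + c : ℤ) : ℝ) / M = (r : ℝ) / (q * M) + t / M + y by
        rw [hy]; push_cast; ring] at h
  rw [Finset.sum_congr rfl e, Finset.sum_sub_distrib, ← Finset.sum_div, ← Finset.mul_sum,
    Finset.sum_sub_distrib, Finset.sum_add_distrib, Finset.sum_add_distrib, h1, h2]
  simp only [Finset.sum_const, Finset.card_range, nsmul_eq_mul]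
  ring

variable {q₁ q₂ : ℕ} (χ₁ : DirichletCharacter ℂ q₁) (χ₂ : DirichletCharacter ℂ q₂)

/-- The twisted double sum of periodic quadratic polynomials. -/
noncomputable def charQuadraticSum : ℂ :=
  ∑ r ∈ Finset.range q₂, ∑ n ∈ Finset.range q₁,
    conj (χ₂ (r : ZMod q₂)) * conj (χ₁ (n : ZMod q₁)) *
      ((Int.fract ((n : ℝ) / q₁ + (r : ℝ) / q₂) ^ 2 -
        Int.fract ((n : ℝ) / q₁ + (r : ℝ) / q₂) : ℝ) : ℂ)

theorem newformDedekindSum_one_add (hq₁ : 0 < q₁) (hq₂ : 1 < q₂) (hχ₁ : χ₁ ≠ 1) :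
    newformDedekindSum χ₁ χ₂ (1 + (q₁ * q₂ : ℕ)) (q₂ * (q₁ * q₂) : ℕ) =
      (q₁ * q₂ : ℕ) / 2 * charQuadraticSum χ₁ χ₂ := by
  have : NeZero q₁ := ⟨hq₁.ne'⟩
  have hM : 0 < q₁ * q₂ := by positivity
  have h1 : (q₁ : ℝ) ≠ 0 := by positivity
  have h2 : (q₂ : ℝ) ≠ 0 := by positivity
  rw [newformDedekindSum_natCast, sum_range_mul_eq, Finset.sum_comm, charQuadraticSum,
    Finset.mul_sum]
  refine Finset.sum_congr rfl fun r _ => ?_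
  by_cases hr : q₂ ∣ r
  · have : Fact (1 < q₂) := ⟨hq₂⟩
    simp [(ZMod.natCast_eq_zero_iff r q₂).2 hr, MulChar.map_zero]
  set M := q₁ * q₂ with hMdef
  have hM' : (M : ℝ) ≠ 0 := by positivity
  have hMr : (M : ℝ) = q₁ * q₂ := by rw [hMdef]; push_cast; rfl
  have e1 : ∀ t ∈ Finset.range M,
      conj (χ₂ ((q₂ * t + r : ℕ) : ZMod q₂)) *
        (sawtooth (((q₂ * t + r : ℕ) : ℝ) / (q₂ * M : ℕ)) : ℝ) *
        charSawtooth χ₁ (((1 + M : ℤ) : ℝ) * (q₂ * t + r : ℕ) / (q₂ * M : ℕ)) =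
      ∑ n ∈ Finset.range q₁, conj (χ₂ (r : ZMod q₂)) * conj (χ₁ (n : ZMod q₁)) *
        ((sawtooth ((r : ℝ) / (q₂ * M) + t / M) *
          sawtooth ((r : ℝ) / (q₂ * M) + t / M + ((n : ℝ) / q₁ + (r : ℝ) / q₂)) : ℝ) : ℂ) := by
    intro t _
    rw [show (((q₂ * t + r : ℕ) : ℝ) / (q₂ * M : ℕ)) = (r : ℝ) / (q₂ * M) + t / M by
        push_cast; field_simp; ring,
      show ((1 + M : ℤ) : ℝ) * (q₂ * t + r : ℕ) / (q₂ * M : ℕ) =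
        ((r : ℝ) / (q₂ * M) + t / M + (r : ℝ) / q₂) + ((t : ℤ) : ℝ) by
        push_cast; field_simp; ring,
      charSawtooth_add_intCast, charSawtooth, Finset.mul_sum]
    refine Finset.sum_congr rfl fun n _ => ?_
    rw [show (r : ℝ) / (q₂ * M) + t / M + ((n : ℝ) / q₁ + (r : ℝ) / q₂) =
      n / q₁ + (r / (q₂ * M) + t / M + r / q₂) by ring]
    push_cast
    rw [ZMod.natCast_self, zero_mul, zero_add]
    ring
  rw [Finset.sum_congr rfl e1, Finset.sum_comm]
  have e2 : ∀ n ∈ Finset.range q₁, ∑ t ∈ Finset.range M,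
      conj (χ₂ (r : ZMod q₂)) * conj (χ₁ (n : ZMod q₁)) *
        ((sawtooth ((r : ℝ) / (q₂ * M) + t / M) *
          sawtooth ((r : ℝ) / (q₂ * M) + t / M + ((n : ℝ) / q₁ + (r : ℝ) / q₂)) : ℝ) : ℂ) =
      conj (χ₂ (r : ZMod q₂)) * ((∑ t ∈ Finset.range M,
          sawtooth ((r : ℝ) / (q₂ * M) + t / M) ^ 2 : ℝ) : ℂ) * conj (χ₁ (n : ZMod q₁)) +
        M / 2 * (conj (χ₂ (r : ZMod q₂)) * conj (χ₁ (n : ZMod q₁)) *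
      ((Int.fract ((n : ℝ) / q₁ + (r : ℝ) / q₂) ^ 2 -
        Int.fract ((n : ℝ) / q₁ + (r : ℝ) / q₂) : ℝ) : ℂ)) := by
    intro n _
    rw [← Finset.mul_sum, ← Complex.ofReal_sum,
      sum_sawtooth_mul_sawtooth (by lia) hM hr (c := n * q₂ + r * q₁)
        (by rw [hMr]; push_cast; field_simp)]
    push_cast
    ring
  rw [Finset.sum_congr rfl e2, Finset.sum_add_distrib, ← Finset.mul_sum, ← Finset.mul_sum,
    sum_conj_eq_zero hχ₁]
  ring

theorem gaussSum_ne_zero_of_isPrimitive {q : ℕ} [NeZero q] {χ : DirichletCharacter ℂ q}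
    (hχ : χ.IsPrimitive) : gaussSum χ ZMod.stdAddChar ≠ 0 := by
  intro h
  have h0 : ZMod.dft (fun a => χ a) = 0 := by
    ext k
    rw [hχ.fourierTransform_eq_inv_mul_gaussSum, h, mul_zero]
    rfl
  have h1 := congrFun ((LinearEquiv.map_eq_zero_iff _).1 h0) 1
  simp at h1

theorem sum_conj_mul_fourier {q : ℕ} [NeZero q] {χ : DirichletCharacter ℂ q}
    (hχ : χ.IsPrimitive) (m : ℤ) :
    ∑ n ∈ Finset.range q, conj (χ (n : ZMod q)) *
        fourier m (((n : ℝ) / q : ℝ) : UnitAddCircle) =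
      χ m * gaussSum χ⁻¹ ZMod.stdAddChar := by
  have hinv : χ⁻¹.IsPrimitive := by
    rw [DirichletCharacter.isPrimitive_def, DirichletCharacter.conductor_inv]
    exact hχ
  have h := gaussSum_mulShift_of_isPrimitive (ZMod.stdAddChar (N := q)) hinv (m : ZMod q)
  rw [inv_inv] at h
  rw [← h, gaussSum, sum_range_eq_sum_zmod (fun n => conj (χ (n : ZMod q)) *
        fourier m (((n : ℝ) / q : ℝ) : UnitAddCircle))]
  refine Finset.sum_congr rfl fun a _ => ?_
  rw [← MulChar.star_apply', ZMod.natCast_zmod_val, AddChar.mulShift_apply, fourier_coe_apply,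
    starRingEnd_apply]
  congr 1
  have e : (m : ZMod q) * a = ((m * a.val : ℤ) : ZMod q) := by simp
  rw [e, ZMod.stdAddChar_coe]
  congr 1
  push_cast
  ring

theorem hasSum_fourier_fract (y : ℝ) :
    HasSum (fun m : ℤ => 1 / (m : ℂ) ^ 2 * fourier m (y : UnitAddCircle))
      (2 * (Real.pi : ℂ) ^ 2 * ((Int.fract y ^ 2 - Int.fract y : ℝ) + 1 / 6)) := by
  have h := hasSum_one_div_pow_mul_fourier_mul_bernoulliFun (k := 2) le_rfl
    (x := Int.fract y) ⟨Int.fract_nonneg y, (Int.fract_lt_one y).le⟩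
  rw [AddCircle.coe_fract, bernoulliFun_two] at h
  convert h using 1
  rw [mul_pow, Complex.I_sq, Nat.factorial_two]
  push_cast
  ring

theorem charQuadraticSum_ne_zero (hq₁ : 1 < q₁) (hq₂ : 1 < q₂) (hχ₁ : χ₁.IsPrimitive)
    (hχ₂ : χ₂.IsPrimitive) (hpar : χ₁ (-1) * χ₂ (-1) = 1) : charQuadraticSum χ₁ χ₂ ≠ 0 := by
  have : NeZero q₁ := ⟨by lia⟩
  have : NeZero q₂ := ⟨by lia⟩
  intro hzero
  set g := gaussSum χ₁⁻¹ ZMod.stdAddChar * gaussSum χ₂⁻¹ ZMod.stdAddChar with hg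
  have hg0 : g ≠ 0 := by
    refine mul_ne_zero (gaussSum_ne_zero_of_isPrimitive ?_) (gaussSum_ne_zero_of_isPrimitive ?_)
    · rw [DirichletCharacter.isPrimitive_def, DirichletCharacter.conductor_inv]
      exact hχ₁
    · rw [DirichletCharacter.isPrimitive_def, DirichletCharacter.conductor_inv]
      exact hχ₂
  have hsum : HasSum (fun m : ℤ => 1 / (m : ℂ) ^ 2 * (χ₁ m * χ₂ m * g)) 0 := by
    have h : HasSum (fun m : ℤ => ∑ r ∈ Finset.range q₂, ∑ n ∈ Finset.range q₁,
        conj (χ₂ (r : ZMod q₂)) * conj (χ₁ (n : ZMod q₁)) * (1 / (m : ℂ) ^ 2 *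
          fourier m (((n : ℝ) / q₁ + (r : ℝ) / q₂ : ℝ) : UnitAddCircle))) _ :=
      hasSum_sum fun r _ => hasSum_sum fun n _ => (hasSum_fourier_fract _).mul_left _
    convert h using 1
    · funext m
      have e1 := sum_conj_mul_fourier hχ₁ m
      have e2 := sum_conj_mul_fourier hχ₂ m
      rw [show χ₁ (m : ZMod q₁) * χ₂ (m : ZMod q₂) * g =
        (χ₂ m * gaussSum χ₂⁻¹ ZMod.stdAddChar) * (χ₁ m * gaussSum χ₁⁻¹ ZMod.stdAddChar) by
          rw [hg]; ring, ← e1, ← e2, Finset.sum_mul_sum, Finset.mul_sum]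
      refine Finset.sum_congr rfl fun r _ => ?_
      rw [Finset.mul_sum]
      refine Finset.sum_congr rfl fun n _ => ?_
      rw [AddCircle.coe_add, fourier_apply, fourier_apply, fourier_apply, smul_add,
        AddCircle.toCircle_add, Circle.coe_mul]
      ring
    · have e : ∀ r ∈ Finset.range q₂, ∑ n ∈ Finset.range q₁,
          conj (χ₂ (r : ZMod q₂)) * conj (χ₁ (n : ZMod q₁)) *
          (2 * (Real.pi : ℂ) ^ 2 * ((Int.fract ((n : ℝ) / q₁ + (r : ℝ) / q₂) ^ 2 -
            Int.fract ((n : ℝ) / q₁ + (r : ℝ) / q₂) : ℝ) + 1 / 6)) =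
          2 * Real.pi ^ 2 * ∑ n ∈ Finset.range q₁,
            conj (χ₂ (r : ZMod q₂)) * conj (χ₁ (n : ZMod q₁)) *
            ((Int.fract ((n : ℝ) / q₁ + (r : ℝ) / q₂) ^ 2 -
              Int.fract ((n : ℝ) / q₁ + (r : ℝ) / q₂) : ℝ) : ℂ) := by
        intro r _
        have h0 : ∑ n ∈ Finset.range q₁, (2 * (Real.pi : ℂ) ^ 2 * (1 / 6) *
            conj (χ₂ (r : ZMod q₂))) * conj (χ₁ (n : ZMod q₁)) = 0 := by
          rw [← Finset.mul_sum, sum_conj_eq_zero (hχ₁.ne_one hq₁), mul_zero]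
        rw [Finset.mul_sum, ← add_zero (∑ n ∈ Finset.range q₁, 2 * (Real.pi : ℂ) ^ 2 * _), ← h0,
          ← Finset.sum_add_distrib]
        refine Finset.sum_congr rfl fun n _ => ?_
        ring
      rw [Finset.sum_congr rfl e, ← Finset.mul_sum]
      rw [charQuadraticSum] at hzero
      rw [hzero, mul_zero]
  set ψ : DirichletCharacter ℂ (q₁ * q₂) :=
    DirichletCharacter.changeLevel (dvd_mul_right q₁ q₂) χ₁ *
      DirichletCharacter.changeLevel (dvd_mul_left q₂ q₁) χ₂ with hψ
  have hψn : ∀ n : ℕ, ψ n = χ₁ n * χ₂ n := by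
    intro n
    by_cases hn : IsCoprime (n : ℤ) (q₁ * q₂ : ℕ)
    · have e1 := DirichletCharacter.changeLevel_eq_cast_of_dvd' χ₁ (dvd_mul_right q₁ q₂) hn
      have e2 := DirichletCharacter.changeLevel_eq_cast_of_dvd' χ₂ (dvd_mul_left q₂ q₁) hn
      rw [hψ, MulChar.mul_apply]
      simpa using congrArg₂ (· * ·) e1 e2
    · have h0 := (DirichletCharacter.apply_eq_zero_iff ψ (n : ℤ)).2 hn
      rw [Int.cast_natCast] at h0
      rw [h0]
      push_cast at hn
      rw [IsCoprime.mul_right_iff, not_and_or] at hn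
      rcases hn with hn | hn
      · have := (DirichletCharacter.apply_eq_zero_iff χ₁ (n : ℤ)).2 hn
        rw [Int.cast_natCast] at this
        rw [this, zero_mul]
      · have := (DirichletCharacter.apply_eq_zero_iff χ₂ (n : ℤ)).2 hn
        rw [Int.cast_natCast] at this
        rw [this, mul_zero]
  refine DirichletCharacter.LSeries_ne_zero_of_one_lt_re ψ (s := 2) (by norm_num) ?_
  have h2 := hsum.nat_add_neg
  have h3 : ∀ n : ℕ, 1 / (((n : ℤ) : ℂ)) ^ 2 * (χ₁ (n : ℤ) * χ₂ (n : ℤ) * g) +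
      1 / (((-(n : ℤ) : ℤ) : ℂ)) ^ 2 * (χ₁ ((-(n : ℤ) : ℤ) : ZMod q₁) *
        χ₂ ((-(n : ℤ) : ℤ) : ZMod q₂) * g) = 2 * g * LSeries.term (fun n => ψ n) 2 n := by
    intro n
    have hneg : χ₁ ((-(n : ℤ) : ℤ) : ZMod q₁) * χ₂ ((-(n : ℤ) : ℤ) : ZMod q₂) =
        χ₁ n * χ₂ n := by
      push_cast
      rw [← neg_one_mul (n : ZMod q₁), ← neg_one_mul (n : ZMod q₂), map_mul, map_mul,
        mul_mul_mul_comm, hpar, one_mul]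
    rw [hneg]
    rcases Nat.eq_zero_or_pos n with rfl | hn
    · simp
    · rw [LSeries.term_of_ne_zero hn.ne', hψn]
      have : (n : ℂ) ≠ 0 := by exact_mod_cast hn.ne'
      rw [show ((2 : ℂ)) = ((2 : ℕ) : ℂ) by norm_num, Complex.cpow_natCast]
      push_cast
      field_simp
      ring
  simp only [h3] at h2
  have h4 := h2.tsum_eq
  rw [tsum_mul_left] at h4
  simp only [Int.cast_zero, ne_eq, OfNat.ofNat_ne_zero, not_false_eq_true, zero_pow, div_zero,
    zero_mul, add_zero] at h4
  exact (mul_eq_zero.1 h4).resolve_left (mul_ne_zero two_ne_zero hg0)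

end Nonvanishing

section Rationality

variable {q₁ q₂ : ℕ} (χ₁ : DirichletCharacter ℂ q₁) (χ₂ : DirichletCharacter ℂ q₂)

theorem exists_SGamma_eq {h : ℤ} {k N : ℕ} (hk : 0 < k) (hN : N ∣ k) (hhk : IsCoprime h k) :
    ∃ γ ∈ CongruenceSubgroup.Gamma0 N, SGamma χ₁ χ₂ γ = newformDedekindSum χ₁ χ₂ h k := by
  obtain ⟨a, b, hab⟩ := hhk
  have hdet : (!![h, -b; (k : ℤ), a]).det = 1 := by
    rw [Matrix.det_fin_two_of]
    linarith
  let γ : Matrix.SpecialLinearGroup (Fin 2) ℤ := ⟨!![h, -b; (k : ℤ), a], hdet⟩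
  refine ⟨γ, ?_, ?_⟩
  · rw [CongruenceSubgroup.Gamma0_mem]
    simpa [γ] using (ZMod.natCast_eq_zero_iff k N).2 hN
  · simp [SGamma, γ, hk]

theorem exists_newformDedekindSum_ne_zero (hq₁ : 1 < q₁) (hq₂ : 1 < q₂) (hχ₁ : χ₁.IsPrimitive)
    (hχ₂ : χ₂.IsPrimitive) (hpar : χ₁ (-1) * χ₂ (-1) = 1) :
    ∃ (h : ℤ) (k : ℕ), 0 < k ∧ q₁ * q₂ ∣ k ∧ IsCoprime h k ∧ newformDedekindSum χ₁ χ₂ h k ≠ 0 := by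
  refine ⟨1 + (q₁ * q₂ : ℕ), q₂ * (q₁ * q₂), by positivity, dvd_mul_left _ _, ?_, ?_⟩
  · have h1 : IsCoprime (1 + (q₁ * q₂ : ℕ) : ℤ) (q₁ * q₂ : ℕ) :=
      ⟨1, -1, by ring⟩
    have h2 : IsCoprime (1 + (q₁ * q₂ : ℕ) : ℤ) q₂ := ⟨1, -q₁, by push_cast; ring⟩
    rw [Nat.cast_mul q₂]
    exact h2.mul_right h1
  · rw [newformDedekindSum_one_add χ₁ χ₂ (by lia) hq₂ (hχ₁.ne_one hq₁)]
    have h1 : ((q₁ * q₂ : ℕ) : ℂ) ≠ 0 := by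
      exact_mod_cast (by positivity : q₁ * q₂ ≠ 0)
    exact mul_ne_zero (div_ne_zero h1 two_ne_zero)
      (charQuadraticSum_ne_zero χ₁ χ₂ hq₁ hq₂ hχ₁ hχ₂ hpar)

variable {χ₁ χ₂}

/-- Reality of the Dedekind sums is inherited by the right hand side of the Hecke relation. -/
theorem hecke_im_eq_zero (hq₁ : 0 < q₁)
    (hreal : ∀ (h : ℤ) (k : ℕ), 0 < k → q₁ * q₂ ∣ k → IsCoprime h k →
      (newformDedekindSum χ₁ χ₂ h k).im = 0)
    {h : ℤ} {k p : ℕ} (hk : 0 < k) (hqk : q₁ * q₂ ∣ k) (hhk : IsCoprime h k) (hp : p.Prime)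
    (hpk : ¬ p ∣ k) :
    ((χ₁ p + p * conj (χ₂ p)) * newformDedekindSum χ₁ χ₂ h k -
        χ₁ p * conj (χ₂ p) * newformDedekindSum χ₁ χ₂ (p * h) k).im = 0 := by
  have : NeZero q₁ := ⟨hq₁.ne'⟩
  have hq₂k : q₂ ∣ k := (dvd_mul_left q₂ q₁).trans hqk
  have hpu : IsUnit (p : ZMod q₁) := by
    rw [ZMod.isUnit_iff_coprime, hp.coprime_iff_not_dvd]
    exact fun hd => hpk (hd.trans ((dvd_mul_right q₁ q₂).trans hqk))
  rw [← sum_newformDedekindSum_add_mul χ₁ χ₂ hk hp hpu hq₂k h, Complex.im_sum]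
  refine Finset.sum_eq_zero fun b _ => ?_
  have hcop : IsCoprime (h + b * k : ℤ) k := hhk.add_mul_right_left b
  by_cases hd : (p : ℤ) ∣ h + b * k
  · obtain ⟨h', hh'⟩ := hd
    rw [hh'] at hcop ⊢
    rw [newformDedekindSum_mul_mul χ₁ χ₂ hk hp.pos hq₂k]
    exact hreal _ _ hk hqk hcop.of_mul_left_right
  · refine hreal _ _ (Nat.mul_pos hp.pos hk) (hqk.trans (dvd_mul_left _ _)) ?_
    rw [Nat.cast_mul]
    refine IsCoprime.mul_right ?_ hcop
    exact ((Nat.prime_iff_prime_int.1 hp).coprime_iff_not_dvd.2 hd).symm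

theorem sq_eq_one_of_im_eq_zero {q k : ℕ} [NeZero k] (hq : q ∣ k) (χ : DirichletCharacter ℂ q)
    (h : ∀ u : ℕ, u.Coprime k → (χ u).im = 0) : χ ^ 2 = 1 := by
  ext a
  obtain ⟨v, hv⟩ := ZMod.unitsMap_surjective hq a
  have hu : (((v : ZMod k).val : ℕ) : ZMod q) = a := by
    rw [← hv, ZMod.natCast_val]
    rfl
  have him := h _ (ZMod.val_coe_unit_coprime v)
  rw [hu] at him
  have h1 := conj_mul_self_of_isUnit χ a.isUnit
  rw [Complex.conj_eq_iff_im.2 him] at h1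
  rw [MulChar.pow_apply_coe, MulChar.one_apply_coe, sq, h1]

theorem sq_eq_one_of_newformDedekindSum_im_eq_zero (hq₁ : 1 < q₁) (hq₂ : 1 < q₂)
    (hχ₁ : χ₁.IsPrimitive) (hχ₂ : χ₂.IsPrimitive) (hpar : χ₁ (-1) * χ₂ (-1) = 1)
    (hreal : ∀ (h : ℤ) (k : ℕ), 0 < k → q₁ * q₂ ∣ k → IsCoprime h k →
      (newformDedekindSum χ₁ χ₂ h k).im = 0) : χ₁ ^ 2 = 1 ∧ χ₂ ^ 2 = 1 := by
  obtain ⟨h, k, hk, hqk, hhk, hne⟩ :=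
    exists_newformDedekindSum_ne_zero χ₁ χ₂ hq₁ hq₂ hχ₁ hχ₂ hpar
  have : NeZero q₁ := ⟨by lia⟩
  have : NeZero k := ⟨hk.ne'⟩
  have hq₁k : q₁ ∣ k := (dvd_mul_right q₁ q₂).trans hqk
  have hq₂k : q₂ ∣ k := (dvd_mul_left q₂ q₁).trans hqk
  set s := newformDedekindSum χ₁ χ₂ h k with hs
  have hsim : s.im = 0 := hreal h k hk hqk hhk
  have hsre : s.re ≠ 0 := fun h0 => hne (Complex.ext h0 hsim)
  have key : ∀ (u : ℤ) (p : ℕ), IsCoprime u k → p.Prime → (p : ℤ) ≡ u [ZMOD k] →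
      ((χ₁ u + p * conj (χ₂ u)) * s -
        χ₁ u * conj (χ₂ u) * newformDedekindSum χ₁ χ₂ (u * h) k).im = 0 := by
    intro u p hu hp hpu
    have hpk : ¬ p ∣ k := by
      intro hd
      obtain ⟨m, hm⟩ := (hpu.of_dvd (Int.natCast_dvd_natCast.2 hd)).dvd
      have hpu' : (p : ℤ) ∣ u := ⟨m + 1, by linarith⟩
      exact (Nat.prime_iff_prime_int.1 hp).not_isUnit
        (hu.isUnit_of_dvd' hpu' (Int.natCast_dvd_natCast.2 hd))
    have hH := hecke_im_eq_zero (by lia) hreal hk hqk hhk hp hpk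
    have e1 : (p : ZMod q₁) = (u : ZMod q₁) := by
      have := (ZMod.intCast_eq_intCast_iff _ _ _).2
        (hpu.of_dvd (Int.natCast_dvd_natCast.2 hq₁k))
      simpa using this
    have e2 : (p : ZMod q₂) = (u : ZMod q₂) := by
      have := (ZMod.intCast_eq_intCast_iff _ _ _).2
        (hpu.of_dvd (Int.natCast_dvd_natCast.2 hq₂k))
      simpa using this
    rwa [e1, e2, newformDedekindSum_congr χ₁ χ₂ hk (hpu.mul_right h)] at hH
  have hχ₂real : ∀ u : ℤ, IsCoprime u k → (χ₂ u).im = 0 := by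
    intro u hu
    obtain ⟨p, -, hp, hpu⟩ := Nat.forall_exists_prime_gt_and_zmodEq 0 hk.ne' hu
    obtain ⟨p', hp'p, hp', hpu'⟩ := Nat.forall_exists_prime_gt_and_zmodEq p hk.ne' hu
    have h1 := key u p hu hp hpu
    have h2 := key u p' hu hp' hpu'
    have hpp : ((p' : ℝ) - p) ≠ 0 := sub_ne_zero.2 (by exact_mod_cast hp'p.ne')
    have h3 : ((p' : ℝ) - p) * s.re * (χ₂ u).im = 0 := by
      simp [Complex.sub_im, Complex.mul_im, Complex.mul_re, hsim] at h1 h2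
      linarith
    exact (mul_eq_zero.1 h3).resolve_left (mul_ne_zero hpp hsre)
  have hχ₁real : ∀ u : ℤ, IsCoprime u k → (χ₁ u).im = 0 := by
    intro u hu
    obtain ⟨p, -, hp, hpu⟩ := Nat.forall_exists_prime_gt_and_zmodEq 0 hk.ne' hu
    obtain ⟨p', -, hp', hpu'⟩ := Nat.forall_exists_prime_gt_and_zmodEq 0 hk.ne' hu.neg_left
    have h1 := key u p hu hp hpu
    have h2 := key (-u) p' hu.neg_left hp' hpu'
    have hx := hχ₂real u hu
    rw [neg_mul, newformDedekindSum_neg] at h2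
    push_cast at h2
    rw [← neg_one_mul (u : ZMod q₁), ← neg_one_mul (u : ZMod q₂), map_mul, map_mul, map_mul] at h2
    have hε : χ₁ (-1) = 1 ∨ χ₁ (-1) = -1 := by
      have : χ₁ (-1) * χ₁ (-1) = 1 := by rw [← map_mul]; simp
      exact mul_self_eq_one_iff.1 this
    have hε₂ : χ₂ (-1) = χ₁ (-1) := by
      rcases hε with h | h <;> rw [h] at hpar ⊢
      · simpa using hpar
      · linear_combination -hpar
    rw [hε₂] at h2
    have h3 : s.re * (χ₁ u).im = 0 := by
      rcases hε with h | h <;> rw [h] at h2 <;>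
      simp [Complex.sub_im, Complex.mul_im, Complex.mul_re, hsim, hx] at h1 h2 <;>
      linarith
    exact (mul_eq_zero.1 h3).resolve_left hsre
  refine ⟨sq_eq_one_of_im_eq_zero hq₁k χ₁ fun u hu => ?_,
    sq_eq_one_of_im_eq_zero hq₂k χ₂ fun u hu => ?_⟩
  · simpa using hχ₁real u (Nat.isCoprime_iff_coprime.2 hu)
  · simpa using hχ₂real u (Nat.isCoprime_iff_coprime.2 hu)

theorem exists_rat_of_sq_eq_one {q : ℕ} {χ : DirichletCharacter ℂ q} (h : χ ^ 2 = 1) (a : ZMod q) :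
    ∃ r : ℚ, conj (χ a) = (r : ℂ) := by
  by_cases ha : IsUnit a
  · have h1 : χ a ^ 2 = 1 := by
      rw [← MulChar.pow_apply' χ two_ne_zero, h, MulChar.one_apply ha]
    rcases mul_self_eq_one_iff.1 ((sq _).symm.trans h1) with h | h
    · exact ⟨1, by simp [h]⟩
    · exact ⟨-1, by simp [h]⟩
  · exact ⟨0, by simp [MulChar.map_nonunit χ ha]⟩

theorem exists_rat_sawtooth (x : ℚ) : ∃ r : ℚ, sawtooth x = r := by
  rw [sawtooth_eq_fract]
  split_ifs
  · exact ⟨0, by simp⟩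
  · exact ⟨Int.fract x - 1 / 2, by simp⟩

theorem newformDedekindSum_rational (h₁ : χ₁ ^ 2 = 1) (h₂ : χ₂ ^ 2 = 1) (h k : ℤ) :
    ∃ r : ℚ, newformDedekindSum χ₁ χ₂ h k = (r : ℂ) := by
  choose f₁ hf₁ using exists_rat_of_sq_eq_one h₁
  choose f₂ hf₂ using exists_rat_of_sq_eq_one h₂
  choose g hg using exists_rat_sawtooth
  refine ⟨∑ j ∈ Finset.range k.toNat, ∑ n ∈ Finset.range q₁, f₂ j * f₁ n * g (j / k) *
    g (n / q₁ + h * j / k), ?_⟩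
  rw [newformDedekindSum]
  push_cast
  refine Finset.sum_congr rfl fun j _ => Finset.sum_congr rfl fun n _ => ?_
  have e1 := hg (j / k)
  have e2 := hg (n / q₁ + h * j / k)
  push_cast at e1 e2
  rw [hf₁, hf₂, e1, e2]
  push_cast
  rfl

end Rationality

/-- `S_{χ₁,χ₂}(γ)` is rational for every `γ ∈ Γ₀(q₁q₂)` if, and only if, `χ₁` and `χ₂`
are quadratic characters (i.e., `χ₁² = 1` and `χ₂² = 1`). -/
theorem rational_values_iff_quadratic {q₁ q₂ : ℕ} (hq₁ : 1 < q₁) (hq₂ : 1 < q₂)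
    (χ₁ : DirichletCharacter ℂ q₁) (χ₂ : DirichletCharacter ℂ q₂)
    (hχ₁ : DirichletCharacter.IsPrimitive χ₁) (hχ₂ : DirichletCharacter.IsPrimitive χ₂)
    (hpar : χ₁ (-1) * χ₂ (-1) = 1) :
    (∀ γ ∈ CongruenceSubgroup.Gamma0 (q₁ * q₂), ∃ r : ℚ, SGamma χ₁ χ₂ γ = (r : ℂ)) ↔
      (χ₁ ^ 2 = 1 ∧ χ₂ ^ 2 = 1) := by
  constructor
  · intro hrat
    refine sq_eq_one_of_newformDedekindSum_im_eq_zero hq₁ hq₂ hχ₁ hχ₂ hpar ?_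
    intro h k hk hqk hhk
    obtain ⟨γ, hγ, hS⟩ := exists_SGamma_eq χ₁ χ₂ hk hqk hhk
    obtain ⟨r, hr⟩ := hrat γ hγ
    rw [← hS, hr, Complex.ratCast_im]
  · rintro ⟨h₁, h₂⟩ γ -
    unfold SGamma
    split_ifs
    · exact newformDedekindSum_rational h₁ h₂ _ _
    · exact newformDedekindSum_rational h₁ h₂ _ _
    · exact ⟨0, by simp⟩
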